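/- Let p be a prime, n ≥ 1, W = W(𝔽_{p^n}), and let φ be the ring automorphism of W induced by the p-power Frobenius of 𝔽_{p^n} (so φ^n = id). Let N be a module over W and let σ : N → N be an additive map that is φ-semilinear, i.e. σ(a • x) = φ(a) • σ(x) for all a ∈ W and x ∈ N, and satisfies σ^n = id_N. Let N^σ = { x ∈ N : σ(x) = x }, which is a module over the fixed subring ℤ_p of W. Then the natural W-linear map W ⊗_{ℤ_p} N^σ → N sending a ⊗ x to a • x is a bijection. -/

import Mathlib

/-!
Galois descent for twisted `W[Gal]`-modules: if `N` is a `W = W(𝔽_{p^n})`-module equipped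
with an additive map `σ : N → N` which is semilinear over the Frobenius `φ` of `W` and
satisfies `σ^n = id`, then the natural `W`-linear map `W ⊗_{ℤ_p} N^σ → N`, `a ⊗ x ↦ a • x`,
is a bijection.  Here `ℤ_p = W(𝔽_p)` is the fixed subring of `W`, and `N` is viewed as a
`ℤ_p`-module by restriction of scalars (expressed by the `IsScalarTower` hypothesis).
-/

open TensorProduct

variable (p n : ℕ) [Fact p.Prime]

/-- `W(𝔽_{p^n})` is an algebra over `ℤ_p = W(𝔽_p)` via Witt vector functoriality. -/
noncomputable instance wittGaloisAlgebra :
    Algebra (WittVector p (ZMod p)) (WittVector p (GaloisField p n)) :=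
  (WittVector.map (algebraMap (ZMod p) (GaloisField p n))).toAlgebra

/-- The Frobenius of `W(𝔽_{p^n})`, induced by the `p`-power Frobenius of `𝔽_{p^n}`. -/
noncomputable def wittFrobenius :
    WittVector p (GaloisField p n) →+* WittVector p (GaloisField p n) :=
  WittVector.map (frobenius (GaloisField p n) p)

lemma wittFrobenius_algebraMap (c : WittVector p (ZMod p)) :
    wittFrobenius p n
        (algebraMap (WittVector p (ZMod p)) (WittVector p (GaloisField p n)) c) =
      algebraMap (WittVector p (ZMod p)) (WittVector p (GaloisField p n)) c := by
  ext k
  simp only [wittFrobenius, RingHom.algebraMap_toAlgebra, WittVector.map_coeff,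
    frobenius_def]
  rw [← map_pow, ZMod.pow_card]

variable (N : Type*) [AddCommGroup N] [Module (WittVector p (GaloisField p n)) N]
  [Module (WittVector p (ZMod p)) N]
  [IsScalarTower (WittVector p (ZMod p)) (WittVector p (GaloisField p n)) N]

/-- The fixed points `N^σ = {x : N | σ x = x}`, as a `ℤ_p`-submodule of `N`. -/
noncomputable def fixedSubmodule (σ : N →+ N)
    (hsemi : ∀ (a : WittVector p (GaloisField p n)) (x : N),
      σ (a • x) = (wittFrobenius p n a) • σ x) :
    Submodule (WittVector p (ZMod p)) N where
  carrier := {x | σ x = x}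
  add_mem' := fun hx hy => by simp only [Set.mem_setOf_eq] at *; rw [map_add, hx, hy]
  zero_mem' := map_zero σ
  smul_mem' := fun c x hx => by
    simp only [Set.mem_setOf_eq] at *
    rw [← algebraMap_smul (WittVector p (GaloisField p n)) c x, hsemi,
      wittFrobenius_algebraMap, algebraMap_smul, hx, algebraMap_smul]

/-- The natural `W`-linear map `W ⊗_{ℤ_p} N^σ → N`, `a ⊗ x ↦ a • x`. -/
noncomputable def descentMap (σ : N →+ N)
    (hsemi : ∀ (a : WittVector p (GaloisField p n)) (x : N),
      σ (a • x) = (wittFrobenius p n a) • σ x) :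
    (WittVector p (GaloisField p n) ⊗[WittVector p (ZMod p)]
        (fixedSubmodule p n N σ hsemi)) →ₗ[WittVector p (ZMod p)] N :=
  TensorProduct.lift <|
    LinearMap.mk₂ (WittVector p (ZMod p))
      (fun (a : WittVector p (GaloisField p n)) (x : fixedSubmodule p n N σ hsemi) =>
        a • (x : N))
      (fun a a' x => add_smul a a' (x : N))
      (fun c a x => smul_assoc c a (x : N))
      (fun a x y => by
        show a • ((x + y : fixedSubmodule p n N σ hsemi) : N) = a • (x : N) + a • (y : N)
        rw [Submodule.coe_add, smul_add])
      (fun c a x => by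
        show a • ((c • x : fixedSubmodule p n N σ hsemi) : N) = c • (a • (x : N))
        rw [Submodule.coe_smul,
          ← algebraMap_smul (WittVector p (GaloisField p n)) c (x : N),
          ← algebraMap_smul (WittVector p (GaloisField p n)) c (a • (x : N)),
          smul_smul, smul_smul, mul_comm])

/-- The trace `∑_{j < n} σ^j x` of an endomorphism with `σ^n = id` is fixed by `σ`. -/
theorem map_sum_range_iterate {M F : Type*} [AddCommMonoid M] [FunLike F M M]
    [AddMonoidHomClass F M M] (σ : F) {n : ℕ} (hord : (⇑σ)^[n] = id) (x : M) :
    σ (∑ j ∈ Finset.range n, (⇑σ)^[j] x) = ∑ j ∈ Finset.range n, (⇑σ)^[j] x := by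
  obtain _ | n := n
  · simp
  rw [map_sum, Finset.sum_range_succ, Finset.sum_range_succ' (fun j => (⇑σ)^[j] x)]
  simp only [← Function.iterate_succ_apply' (⇑σ), hord, id_eq, Function.iterate_zero]

/-- Iterates of a semilinear map are semilinear over the iterated ring endomorphism. -/
theorem iterate_semilinear {S M : Type*} [SMul S M] {φ : S → S} {σ : M → M}
    (hsemi : ∀ (a : S) (x : M), σ (a • x) = φ a • σ x) (j : ℕ) (a : S) (x : M) :
    σ^[j] (a • x) = φ^[j] a • σ^[j] x := by
  induction j with
  | zero => rfl
  | succ j ih => simp only [Function.iterate_succ_apply', ih, hsemi]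

/-- Galois coordinates `x i`, `y i` of a ring recover a module element from the traces of its
multiples by the `y i`. -/
theorem sum_smul_trace_eq {S M ι : Type*} [CommRing S] [AddCommGroup M] [Module S M]
    {φ : S → S} {σ : M → M} (hsemi : ∀ (a : S) (x : M), σ (a • x) = φ a • σ x)
    {n : ℕ} (hn : 1 ≤ n) (s : Finset ι) (x y : ι → S)
    (hxy : ∀ j < n, ∑ i ∈ s, x i * φ^[j] (y i) = if j = 0 then 1 else 0) (m : M) :
    ∑ i ∈ s, x i • ∑ j ∈ Finset.range n, σ^[j] (y i • m) = m := by
  simp_rw [Finset.smul_sum, iterate_semilinear hsemi, smul_smul]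
  rw [Finset.sum_comm]
  simp_rw [← Finset.sum_smul]
  rw [Finset.sum_congr rfl fun j hj => by rw [hxy j (Finset.mem_range.1 hj)]]
  simp only [ite_smul, one_smul, zero_smul]
  rw [Finset.sum_ite_eq' (Finset.range n) 0 (fun j => σ^[j] m)]
  simp [Nat.pos_iff_ne_zero.1 hn]

/-- An element `a` such that `a - φ^j a` is a unit for `0 < j < n` yields Galois coordinates. -/
theorem exists_galois_coordinates {S : Type*} [CommRing S] (φ : S →+* S) (n : ℕ) (a : S)
    (ha : ∀ j, 0 < j → j < n → IsUnit (a - (⇑φ)^[j] a)) :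
    ∃ (d : ℕ) (x y : ℕ → S), ∀ j < n,
      ∑ i ∈ Finset.range d, x i * (⇑φ)^[j] (y i) = if j = 0 then 1 else 0 := by
  let Q : Polynomial S :=
    ∏ j ∈ Finset.Ico 1 n, (Polynomial.X - Polynomial.C ((⇑φ)^[j] a))
  have hQ : IsUnit (Q.eval a) := by
    simp only [Q, Polynomial.eval_prod, Polynomial.eval_sub, Polynomial.eval_X,
      Polynomial.eval_C]
    refine IsUnit.prod_iff.2 fun j hj => ?_
    rw [Finset.mem_Ico] at hj
    exact ha j hj.1 hj.2
  obtain ⟨c, hc⟩ := hQ.exists_right_inv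
  refine ⟨Q.natDegree + 1, fun i => c * Q.coeff i, fun i => a ^ i, fun j hj => ?_⟩
  have key : ∑ i ∈ Finset.range (Q.natDegree + 1), c * Q.coeff i * (⇑φ)^[j] (a ^ i) =
      c * Q.eval ((⇑φ)^[j] a) := by
    rw [Polynomial.eval_eq_sum_range, Finset.mul_sum]
    refine Finset.sum_congr rfl fun i _ => ?_
    rw [iterate_map_pow, mul_assoc]
  rw [key]
  split_ifs with h
  · subst h
    rw [mul_comm]
    exact hc
  · have : Q.eval ((⇑φ)^[j] a) = 0 := by
      simp only [Q, Polynomial.eval_prod]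
      refine Finset.prod_eq_zero (i := j) (Finset.mem_Ico.2 ⟨by omega, hj⟩) ?_
      simp
    rw [this, mul_zero]

theorem wittFrobenius_iterate_coeff (j k : ℕ) (a : WittVector p (GaloisField p n)) :
    ((⇑(wittFrobenius p n))^[j] a).coeff k = a.coeff k ^ p ^ j := by
  induction j with
  | zero => simp
  | succ j ih =>
    rw [Function.iterate_succ_apply', wittFrobenius, WittVector.map_coeff, ← wittFrobenius, ih,
      frobenius_def, ← pow_mul, pow_succ]

theorem wittFrobenius_iterate_eq_id (hn : 1 ≤ n) : (⇑(wittFrobenius p n))^[n] = id := by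
  have := Fintype.ofFinite (GaloisField p n)
  funext a
  ext k
  rw [wittFrobenius_iterate_coeff, id_eq, ← GaloisField.card p n (by omega),
    Nat.card_eq_fintype_card, FiniteField.pow_card]

/-- The elements of `W(𝔽_{p^n})` fixed by Frobenius come from `ℤ_p = W(𝔽_p)`. -/
theorem exists_algebraMap_eq_of_wittFrobenius_eq (a : WittVector p (GaloisField p n))
    (ha : wittFrobenius p n a = a) :
    ∃ c : WittVector p (ZMod p),
      algebraMap (WittVector p (ZMod p)) (WittVector p (GaloisField p n)) c = a := by
  have h (k : ℕ) : ∃ c : ZMod p, algebraMap (ZMod p) (GaloisField p n) c = a.coeff k := by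
    have hk : a.coeff k ^ p = a.coeff k := by
      simpa only [Function.iterate_one, pow_one, ha] using
        (wittFrobenius_iterate_coeff p n 1 k a).symm
    rw [← Subfield.mem_bot_iff_pow_eq_self, ← ZMod.fieldRange_castHom_eq_bot p] at hk
    obtain ⟨c, hc⟩ := hk
    exact ⟨c, by rw [← hc]; exact RingHom.congr_fun (Subsingleton.elim _ _) c⟩
  choose c hc using h
  refine ⟨WittVector.mk p c, ?_⟩
  ext k
  rw [RingHom.algebraMap_toAlgebra, WittVector.map_coeff]
  exact hc k

theorem exists_isUnit_sub_wittFrobenius_iterate (hn : 1 ≤ n) :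
    ∃ a : WittVector p (GaloisField p n),
      ∀ j, 0 < j → j < n → IsUnit (a - (⇑(wittFrobenius p n))^[j] a) := by
  have hp := (Fact.out : p.Prime)
  obtain ⟨t, ht⟩ := IsCyclic.exists_ofOrder_eq_natCard (α := (GaloisField p n)ˣ)
  rw [Nat.card_units, GaloisField.card p n (by omega)] at ht
  refine ⟨WittVector.teichmuller p (t : GaloisField p n), fun j hj hjn => ?_⟩
  refine WittVector.isUnit_of_coeff_zero_ne_zero _ ?_
  rw [← WittVector.constantCoeff_apply, map_sub, WittVector.constantCoeff_apply,
    WittVector.constantCoeff_apply, wittFrobenius_iterate_coeff,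
    WittVector.teichmuller_coeff_zero, sub_ne_zero]
  intro h
  have h1 : 1 < p ^ j := Nat.one_lt_pow hj.ne' hp.one_lt
  have h2 : p ^ j < p ^ n := Nat.pow_lt_pow_right hp.one_lt hjn
  have h3 : t ^ (p ^ j - 1) = 1 := by
    have h4 : t ^ (p ^ j - 1) * t = 1 * t := by
      rw [← pow_succ, Nat.sub_add_cancel h1.le, one_mul]
      exact Units.ext (by push_cast; exact h.symm)
    exact mul_right_cancel h4
  have := Nat.le_of_dvd (by omega) (ht ▸ orderOf_dvd_of_pow_eq_one h3)
  omega

theorem descentMap_tmul (σ : N →+ N)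
    (hsemi : ∀ (a : WittVector p (GaloisField p n)) (x : N),
      σ (a • x) = (wittFrobenius p n a) • σ x)
    (a : WittVector p (GaloisField p n)) (x : fixedSubmodule p n N σ hsemi) :
    descentMap p n N σ hsemi (a ⊗ₜ x) = a • (x : N) := rfl

/-- Galois descent: the natural map `W ⊗_{ℤ_p} N^σ → N` is a bijection whenever
`σ` is Frobenius-semilinear and `σ^n = id` with `n ≥ 1`. -/
theorem descentMap_bijective (hn : 1 ≤ n) (σ : N →+ N)
    (hsemi : ∀ (a : WittVector p (GaloisField p n)) (x : N),
      σ (a • x) = (wittFrobenius p n a) • σ x)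
    (hord : (⇑σ)^[n] = id) :
    Function.Bijective (descentMap p n N σ hsemi) := by
  obtain ⟨a, ha⟩ := exists_isUnit_sub_wittFrobenius_iterate p n hn
  obtain ⟨d, x, y, hxy⟩ := exists_galois_coordinates (wittFrobenius p n) n a ha
  let T : N →+ fixedSubmodule p n N σ hsemi :=
    { toFun := fun m => ⟨∑ j ∈ Finset.range n, (⇑σ)^[j] m, map_sum_range_iterate σ hord m⟩
      map_zero' := Subtype.ext (by simp [iterate_map_zero])
      map_add' := fun m m' => Subtype.ext (by
        simp [iterate_map_add, Finset.sum_add_distrib]) }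
  have hT (m : N) : (T m : N) = ∑ j ∈ Finset.range n, (⇑σ)^[j] m := rfl
  refine Function.bijective_iff_has_inverse.2
    ⟨fun m => ∑ i ∈ Finset.range d, x i ⊗ₜ T (y i • m), fun z => ?_, fun m => ?_⟩
  · induction z using TensorProduct.induction_on with
    | zero => simp
    | add z w hz hw =>
      simp only [map_add, smul_add, TensorProduct.tmul_add, Finset.sum_add_distrib] at hz hw ⊢
      rw [hz, hw]
    | tmul b m =>
      have hm : σ (m : N) = m := m.2
      choose c hc using fun i => exists_algebraMap_eq_of_wittFrobenius_eq p n _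
        (map_sum_range_iterate (wittFrobenius p n) (wittFrobenius_iterate_eq_id p n hn)
          (y i • b))
      have hTc (i : ℕ) : T (y i • b • (m : N)) = c i • m := by
        refine Subtype.ext ?_
        rw [hT, Submodule.coe_smul, ← algebraMap_smul (WittVector p (GaloisField p n)) (c i), hc,
          Finset.sum_smul]
        refine Finset.sum_congr rfl fun j _ => ?_
        rw [← smul_assoc, iterate_semilinear hsemi, Function.iterate_fixed hm]
      simp only [descentMap_tmul, hTc]
      simp_rw [← TensorProduct.smul_tmul, ← TensorProduct.sum_tmul]
      congr 1
      simp_rw [Algebra.smul_def, hc, mul_comm _ (x _)]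
      exact sum_smul_trace_eq (fun a b => map_mul (wittFrobenius p n) a b) hn _ x y hxy b
  · simp only [map_sum, descentMap_tmul, hT]
    exact sum_smul_trace_eq hsemi hn _ x y hxy m
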